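/- arXiv:2109.00734 — 3 statements merged into one kernel-verified Lean document; each statement's English description precedes it below -/
import Mathlib

section
/- For every integer k with 2 ≤ k ≤ 6, the Ramsey number of trails with k vertices equals k: every simple graph on k vertices or its complement contains a trail with k vertices, and there exists a simple graph on k − 1 vertices such that neither it nor its complement contains a trail with k vertices. -/
/-- A graph `G` contains a trail with `k` vertices (counted with multiplicity),
i.e., a walk of length `k - 1` whose edges are pairwise distinct. -/
def HasTrailWithVertices {V : Type*} (G : SimpleGraph V) (k : ℕ) : Prop :=
  ∃ (u v : V) (p : G.Walk u v), p.IsTrail ∧ p.length + 1 = k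

section

open SimpleGraph

variable {V : Type*} {G : SimpleGraph V}

theorem hasTrailWithVertices_iff_exists_list {k : ℕ} (hk : 0 < k) :
    HasTrailWithVertices G k ↔ ∃ l : List V, l.length = k ∧ l.IsChain G.Adj ∧
      (List.zipWith (s(·, ·)) l l.tail).Nodup := by
  constructor
  · rintro ⟨u, v, p, hp, hpk⟩
    refine ⟨p.support, by rw [Walk.length_support, hpk], p.isChain_adj_support, ?_⟩
    rw [← Walk.edges_eq_zipWith_support]
    exact hp.edges_nodup
  · rintro ⟨l, rfl, hc, hn⟩
    refine ⟨_, _, .ofSupport l (List.length_pos_iff.mp hk) hc, ?_, ?_⟩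
    · rwa [Walk.isTrail_def, Walk.edges_eq_zipWith_support, Walk.support_ofSupport]
    · rw [Walk.length_ofSupport]
      omega

theorem exists_notMem_of_length_lt_card [Fintype V] {l : List V}
    (h : l.length < Fintype.card V) : ∃ x, x ∉ l := by
  classical
  have hc : l.toFinset.card < (Finset.univ : Finset V).card := l.toFinset_card_le.trans_lt h
  obtain ⟨x, -, hx⟩ := Finset.exists_mem_notMem_of_card_lt_card hc
  exact ⟨x, by simpa using hx⟩

theorem hasTrailWithVertices_two_or_compl [Fintype V] (hV : 2 ≤ Fintype.card V) :
    HasTrailWithVertices G 2 ∨ HasTrailWithVertices Gᶜ 2 := by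
  obtain ⟨a, b, hab⟩ := Fintype.exists_pair_of_one_lt_card hV
  simp only [hasTrailWithVertices_iff_exists_list Nat.two_pos]
  by_cases h : G.Adj a b
  · exact .inl ⟨[a, b], by simp [h]⟩
  · exact .inr ⟨[a, b], by simp [h, hab]⟩

theorem HasTrailWithVertices.three_or_compl [Fintype V] (hV : 3 ≤ Fintype.card V)
    (h : HasTrailWithVertices G 2) :
    HasTrailWithVertices G 3 ∨ HasTrailWithVertices Gᶜ 3 := by
  rw [hasTrailWithVertices_iff_exists_list (by simp)] at h ⊢
  rw [hasTrailWithVertices_iff_exists_list (by simp)]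
  by_contra! ⟨hG, hG'⟩
  obtain ⟨l, hl, hc, hn⟩ := h
  match l, hl with
  | [a, b], _ =>
  obtain ⟨c, hx⟩ := exists_notMem_of_length_lt_card (l := [a, b]) hV
  have h₁ := hG [a, b, c] rfl
  have h₂ := hG [b, a, c] rfl
  have h₃ := hG' [a, c, b] rfl
  simp at hc hx h₁ h₂ h₃
  grind [SimpleGraph.Adj.symm, SimpleGraph.Adj.ne]

theorem HasTrailWithVertices.four_or_compl [Fintype V] (hV : 4 ≤ Fintype.card V)
    (h : HasTrailWithVertices G 3) :
    HasTrailWithVertices G 4 ∨ HasTrailWithVertices Gᶜ 4 := by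
  rw [hasTrailWithVertices_iff_exists_list (by simp)] at h ⊢
  rw [hasTrailWithVertices_iff_exists_list (by simp)]
  by_contra! ⟨hG, hG'⟩
  obtain ⟨l, hl, hc, hn⟩ := h
  match l, hl with
  | [a, b, c], _ =>
  obtain ⟨d, hx⟩ := exists_notMem_of_length_lt_card (l := [a, b, c]) hV
  have h₁ x := hG [a, b, c, x] rfl
  have h₂ x := hG [x, a, b, c] rfl
  have h₃ := hG' [a, c, d, a] rfl
  simp at hc hn hx h₁ h₂ h₃
  grind [SimpleGraph.Adj.symm, SimpleGraph.Adj.ne]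

theorem HasTrailWithVertices.five_or_compl [Fintype V] (hV : 5 ≤ Fintype.card V)
    (h : HasTrailWithVertices G 4) :
    HasTrailWithVertices G 5 ∨ HasTrailWithVertices Gᶜ 5 := by
  rw [hasTrailWithVertices_iff_exists_list (by simp)] at h ⊢
  rw [hasTrailWithVertices_iff_exists_list (by simp)]
  by_contra! ⟨hG, hG'⟩
  obtain ⟨l, hl, hc, hn⟩ := h
  match l, hl with
  | [a, b, c, d], _ =>
  obtain ⟨e, hx⟩ := exists_notMem_of_length_lt_card (l := [a, b, c, d]) hV
  have h₁ x := hG [a, b, c, d, x] rfl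
  have h₂ x := hG [x, a, b, c, d] rfl
  by_cases had : a = d
  · subst had
    obtain ⟨f, hy⟩ := exists_notMem_of_length_lt_card (l := [a, b, c, e]) hV
    have h₃ x := hG [x, b, c, a, b] rfl
    have h₄ x := hG [x, c, a, b, c] rfl
    have h₅ := hG' [a, e, b, f, c] rfl
    simp at hc hn hx hy h₁ h₂ h₃ h₄ h₅
    grind [SimpleGraph.Adj.symm, SimpleGraph.Adj.ne]
  · have h₃ := hG' [c, a, e, d, b] rfl
    simp at hc hn hx h₁ h₂ h₃
    grind [SimpleGraph.Adj.symm, SimpleGraph.Adj.ne]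

theorem hasTrailWithVertices_six_or_compl_of_triangle [Fintype V] (hV : 6 ≤ Fintype.card V)
    {a b c d : V} (hab : G.Adj a b) (hbc : G.Adj b c) (hca : G.Adj c a) (had : G.Adj a d)
    (hdb : d ≠ b) (hdc : d ≠ c) :
    HasTrailWithVertices G 6 ∨ HasTrailWithVertices Gᶜ 6 := by
  simp only [hasTrailWithVertices_iff_exists_list (Nat.succ_pos 5)]
  by_contra! ⟨hG, hG'⟩
  obtain ⟨e, hx⟩ := exists_notMem_of_length_lt_card (l := [a, b, c, d])
    (show 4 < _ by omega)
  obtain ⟨f, hy⟩ := exists_notMem_of_length_lt_card (l := [a, b, c, d, e]) hV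
  have h₁ x := hG [x, d, a, b, c, a] rfl
  have h₂ x := hG [d, a, b, c, a, x] rfl
  have h₃ := hG' [b, d, e, a, f, d] rfl
  simp at hx hy h₁ h₂ h₃
  grind [SimpleGraph.Adj.symm, SimpleGraph.Adj.ne]

theorem HasTrailWithVertices.six_or_compl [Fintype V] (hV : 6 ≤ Fintype.card V)
    (h : HasTrailWithVertices G 5) :
    HasTrailWithVertices G 6 ∨ HasTrailWithVertices Gᶜ 6 := by
  rw [hasTrailWithVertices_iff_exists_list (by simp)] at h
  obtain ⟨l, hl, hc, hn⟩ := h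
  match l, hl with
  | [a, b, c, d, e], _ =>
  simp at hc hn
  obtain ⟨hab, hbc, hcd, hde⟩ := hc
  by_cases had : a = d
  · subst had
    exact hasTrailWithVertices_six_or_compl_of_triangle hV hab hbc hcd hde (by grind) (by grind)
  by_cases hbe : b = e
  · subst hbe
    exact hasTrailWithVertices_six_or_compl_of_triangle hV hbc hcd hde hab.symm
      (by grind) (by grind)
  simp only [hasTrailWithVertices_iff_exists_list (Nat.succ_pos 5)]
  by_contra! ⟨hG, hG'⟩
  by_cases hae : a = e
  · subst hae
    obtain ⟨e, hx⟩ := exists_notMem_of_length_lt_card (l := [a, b, c, d])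
      (show 4 < _ by omega)
    obtain ⟨f, hy⟩ := exists_notMem_of_length_lt_card (l := [a, b, c, d, e]) hV
    have h₁ x := hG [x, a, b, c, d, a] rfl
    have h₂ x := hG [x, b, c, d, a, b] rfl
    have h₃ x := hG [x, c, d, a, b, c] rfl
    have h₄ := hG' [a, e, b, f, c, e] rfl
    simp at hx hy h₁ h₂ h₃ h₄
    grind [SimpleGraph.Adj.symm, SimpleGraph.Adj.ne]
  · obtain ⟨f, hx⟩ := exists_notMem_of_length_lt_card (l := [a, b, c, d, e]) hV
    have h₁ x := hG [x, a, b, c, d, e] rfl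
    have h₂ x := hG [a, b, c, d, e, x] rfl
    have h₃ := hG' [d, a, c, e, f, a] rfl
    simp at hx h₁ h₂ h₃
    grind [SimpleGraph.Adj.symm, SimpleGraph.Adj.ne]

theorem hasTrailWithVertices_succ_or_compl {k : ℕ}
    (hstep : ∀ H : SimpleGraph V, HasTrailWithVertices H k →
      HasTrailWithVertices H (k + 1) ∨ HasTrailWithVertices Hᶜ (k + 1))
    (h : HasTrailWithVertices G k ∨ HasTrailWithVertices Gᶜ k) :
    HasTrailWithVertices G (k + 1) ∨ HasTrailWithVertices Gᶜ (k + 1) := by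
  rcases h with h | h
  · exact hstep G h
  · simpa [or_comm] using hstep Gᶜ h

theorem hasTrailWithVertices_or_compl [Fintype V] {k : ℕ} (hk2 : 2 ≤ k) (hk6 : k ≤ 6)
    (hV : k ≤ Fintype.card V) :
    HasTrailWithVertices G k ∨ HasTrailWithVertices Gᶜ k := by
  induction k, hk2 using Nat.le_induction with
  | base => exact hasTrailWithVertices_two_or_compl hV
  | succ k hk2 ih =>
    refine hasTrailWithVertices_succ_or_compl (fun H h ↦ ?_) (ih (by omega) (by omega))
    have hk5 : k ≤ 5 := by omega
    interval_cases k
    · exact h.three_or_compl hV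
    · exact h.four_or_compl hV
    · exact h.five_or_compl hV
    · exact h.six_or_compl hV

theorem not_hasTrailWithVertices_of_card_edgeFinset_lt [Fintype G.edgeSet] {k : ℕ}
    (h : G.edgeFinset.card + 1 < k) : ¬ HasTrailWithVertices G k := by
  rintro ⟨u, v, p, hp, hk⟩
  have := hp.length_le_card_edgeFinset
  omega

theorem SimpleGraph.Walk.IsTrail.isEulerian_of_length_eq [DecidableEq V] [Fintype G.edgeSet]
    {u v : V} {p : G.Walk u v} (hp : p.IsTrail) (h : p.length = G.edgeFinset.card) :
    p.IsEulerian := by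
  refine p.isEulerian_iff.mpr ⟨hp, fun e he ↦ ?_⟩
  have hsub : hp.edgesFinset ⊆ G.edgeFinset := fun e he ↦
    mem_edgeFinset.mpr (p.edges_subset_edgeSet he)
  have hcard : hp.edgesFinset.card = p.length := p.length_edges
  have heq := Finset.eq_of_subset_of_card_le hsub (by rw [hcard, h])
  have hmem : e ∈ hp.edgesFinset := heq ▸ mem_edgeFinset.mpr he
  exact hmem

theorem not_hasTrailWithVertices_of_two_lt_card_odd_degree [Fintype V] [DecidableEq V]
    [DecidableRel G.Adj] (h : 2 < Finset.card {v | Odd (G.degree v)}) :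
    ¬ HasTrailWithVertices G (G.edgeFinset.card + 1) := by
  rintro ⟨u, v, p, hp, hk⟩
  have := (hp.isEulerian_of_length_eq (Nat.succ_injective hk)).card_odd_degree
  simp only [Set.coe_ofPred, Fintype.card_subtype] at this
  omega

/-- The bull graph: a triangle with pendant edges at two of its vertices. -/
def bull : SimpleGraph (Fin 5) :=
  fromEdgeSet {s(0, 1), s(1, 2), s(2, 0), s(0, 3), s(1, 4)}

instance : DecidableRel bull.Adj := inferInstanceAs (DecidableRel (fromEdgeSet _).Adj)

theorem exists_not_hasTrailWithVertices_and_compl {k : ℕ} (hk2 : 2 ≤ k) (hk6 : k ≤ 6) :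
    ∃ G : SimpleGraph (Fin (k - 1)),
      ¬ HasTrailWithVertices G k ∧ ¬ HasTrailWithVertices Gᶜ k := by
  have few {n k : ℕ} (G : SimpleGraph (Fin n)) [DecidableRel G.Adj]
      (h : G.edgeFinset.card + 1 < k ∧ Gᶜ.edgeFinset.card + 1 < k) :
      ¬ HasTrailWithVertices G k ∧ ¬ HasTrailWithVertices Gᶜ k :=
    ⟨not_hasTrailWithVertices_of_card_edgeFinset_lt h.1,
      not_hasTrailWithVertices_of_card_edgeFinset_lt h.2⟩
  interval_cases k
  · exact ⟨⊥, few _ (by decide)⟩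
  · exact ⟨⊥, few _ (by decide)⟩
  · exact ⟨fromEdgeSet {s(0, 1)}, few _ (by decide)⟩
  · exact ⟨fromEdgeSet {s(0, 1), s(0, 2), s(0, 3)}, few _ (by decide)⟩
  · exact ⟨bull, not_hasTrailWithVertices_of_two_lt_card_odd_degree (G := bull) (by decide),
      not_hasTrailWithVertices_of_two_lt_card_odd_degree (G := bullᶜ) (by decide)⟩

end

/-- For every integer `k` with `2 ≤ k ≤ 6`, the Ramsey number of trails with `k`
vertices equals `k`: every simple graph on `k` vertices or its complement contains
a trail with `k` vertices, and there is a simple graph on `k - 1` vertices such that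
neither it nor its complement contains a trail with `k` vertices. -/
theorem ramsey_trail_eq_small (k : ℕ) (hk2 : 2 ≤ k) (hk6 : k ≤ 6) :
    (∀ G : SimpleGraph (Fin k),
      HasTrailWithVertices G k ∨ HasTrailWithVertices Gᶜ k) ∧
    (∃ G : SimpleGraph (Fin (k - 1)),
      ¬ HasTrailWithVertices G k ∧ ¬ HasTrailWithVertices Gᶜ k) := by
  exact ⟨fun _ ↦ hasTrailWithVertices_or_compl hk2 hk6 (by simp),
    exists_not_hasTrailWithVertices_and_compl hk2 hk6⟩
end

section
/- For every simple graph G on 7 vertices, either G or its complement contains a trail with 10 vertices. -/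
/-- The edges traversed by the walk visiting the vertices of a list in order. -/
def stepEdges {V : Type*} : List V → List (Sym2 V)
  | a :: b :: l => s(a, b) :: stepEdges (b :: l)
  | _ => []

theorem exists_walk_edges_eq_stepEdges {V : Type*} {G : SimpleGraph V} (l : List V) (a : V)
    (h : ∀ e ∈ stepEdges (a :: l), e ∈ G.edgeSet) :
    ∃ (b : V) (p : G.Walk a b), p.edges = stepEdges (a :: l) := by
  induction l generalizing a with
  | nil => exact ⟨a, .nil, rfl⟩
  | cons c l ih =>
    obtain ⟨b, p, hp⟩ := ih c fun e he ↦ h e (List.mem_cons_of_mem _ he)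
    have hac : G.Adj a c := h s(a, c) List.mem_cons_self
    exact ⟨b, .cons hac p, by simp [stepEdges, hp]⟩

theorem HasTrailWithVertices.of_stepEdges {V : Type*} {G : SimpleGraph V} {l : List V} {k : ℕ}
    (hG : ∀ e ∈ stepEdges l, e ∈ G.edgeSet) (hl : (stepEdges l).Nodup)
    (hk : (stepEdges l).length + 1 = k) (hne : l ≠ []) : HasTrailWithVertices G k := by
  obtain ⟨a, l, rfl⟩ := List.exists_cons_of_ne_nil hne
  obtain ⟨b, p, hp⟩ := exists_walk_edges_eq_stepEdges l a hG
  exact ⟨a, b, p, ⟨hp ▸ hl⟩, by rw [← SimpleGraph.Walk.length_edges, hp, hk]⟩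

theorem HasTrailWithVertices.map {V W : Type*} {G : SimpleGraph V} {H : SimpleGraph W} {k : ℕ}
    (f : G →g H) (hf : Function.Injective f) (h : HasTrailWithVertices G k) :
    HasTrailWithVertices H k := by
  obtain ⟨u, v, p, hp, hk⟩ := h
  exact ⟨f u, f v, p.map f, (SimpleGraph.Walk.isTrail_map_iff_of_injective hf).2 hp, by simpa⟩

/-- Every graph containing the edges in `S.1` and missing those in `S.2` has a trail with `10`
vertices, or its complement does. -/
def ForcesTrail (S : List (Sym2 (Fin 7)) × List (Sym2 (Fin 7))) : Prop :=
  ∀ G : SimpleGraph (Fin 7), (∀ e ∈ S.1, e ∈ G.edgeSet) → (∀ e ∈ S.2, e ∈ Gᶜ.edgeSet) →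
    HasTrailWithVertices G 10 ∨ HasTrailWithVertices Gᶜ 10

namespace ForcesTrail

variable {R B R₀ B₀ : List (Sym2 (Fin 7))}

theorem swap (h : ForcesTrail (R, B)) : ForcesTrail (B, R) := fun G hB hR ↦ by
  simpa [or_comm] using h Gᶜ hR (by simpa using hB)

theorem split {i j : Fin 7} (hij : i ≠ j) (hR : ForcesTrail (s(i, j) :: R, B))
    (hB : ForcesTrail (R, s(i, j) :: B)) : ForcesTrail (R, B) := fun G h₁ h₂ ↦ by
  by_cases h : G.Adj i j
  · exact hR G (List.forall_mem_cons.2 ⟨h, h₁⟩) h₂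
  · exact hB G h₁ (List.forall_mem_cons.2 ⟨(G.compl_adj i j).2 ⟨hij, h⟩, h₂⟩)

theorem of_injective {f : Fin 7 → Fin 7} (hf : Function.Injective f) (h : ForcesTrail (R₀, B₀))
    (hR : ∀ e ∈ R₀, e.map f ∈ R) (hB : ∀ e ∈ B₀, e.map f ∈ B) : ForcesTrail (R, B) := by
  intro G h₁ h₂
  let φ : G.comap f →g G := ⟨f, id⟩
  let ψ : (G.comap f)ᶜ →g Gᶜ := ⟨f, fun {a b} hab ↦
    (G.compl_adj _ _).2 ⟨hf.ne ((SimpleGraph.compl_adj _ a b).1 hab).1,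
      ((SimpleGraph.compl_adj _ a b).1 hab).2⟩⟩
  refine (h (G.comap f) (fun e he ↦ ?_) (fun e he ↦ ?_)).imp
    (HasTrailWithVertices.map φ hf) (HasTrailWithVertices.map ψ hf)
  · have := h₁ _ (hR e he)
    induction e with | _ a b => simpa using this
  · have := h₂ _ (hB e he)
    induction e with
    | _ a b =>
      simp only [Sym2.map_mk, SimpleGraph.mem_edgeSet, SimpleGraph.compl_adj] at this
      exact (SimpleGraph.compl_adj _ a b).2 ⟨fun hab ↦ this.1 (congrArg f hab), this.2⟩

end ForcesTrail

/-- A derivation that a partial red/blue colouring of the edges of the complete graph on seven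
vertices forces a monochromatic trail with `10` vertices. -/
inductive TrailCertificate
  /-- A red trail, given by its vertices. -/
  | red (l : List (Fin 7))
  /-- A blue trail, given by its vertices. -/
  | blue (l : List (Fin 7))
  /-- A case distinction on the colour of an edge: first red, then blue. -/
  | split (i j : Fin 7) (r b : TrailCertificate)
  /-- The `k`-th known colouring embeds along the listed relabelling of the vertices. -/
  | relabel (k : ℕ) (σ : List (Fin 7))
  /-- As `relabel`, with the two colours exchanged. -/
  | relabelSwap (k : ℕ) (σ : List (Fin 7))

namespace TrailCertificate

/-- Whether `l` lists the vertices of a trail with `10` vertices and all edges in `R`. -/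
def checkTrail (R : List (Sym2 (Fin 7))) (l : List (Fin 7)) : Bool :=
  decide ((stepEdges l).length = 9) && (stepEdges l).all (fun e ↦ decide (e ∈ R)) &&
    decide (stepEdges l).Nodup

/-- Whether relabelling along `σ` embeds the colouring `S` into the colouring `(R, B)`. -/
def checkEmbedding (S : List (Sym2 (Fin 7)) × List (Sym2 (Fin 7))) (σ : List (Fin 7))
    (R B : List (Sym2 (Fin 7))) : Bool :=
  decide (Function.Injective fun i : Fin 7 ↦ σ.getD i 0) &&
    S.1.all (fun e ↦ decide (e.map (fun i : Fin 7 ↦ σ.getD i 0) ∈ R)) &&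
    S.2.all (fun e ↦ decide (e.map (fun i : Fin 7 ↦ σ.getD i 0) ∈ B))

/-- Whether a certificate is valid for the colouring `(R, B)`, given a list of known colourings. -/
def check (known : List (List (Sym2 (Fin 7)) × List (Sym2 (Fin 7)))) :
    TrailCertificate → List (Sym2 (Fin 7)) → List (Sym2 (Fin 7)) → Bool
  | red l, R, _ => checkTrail R l
  | blue l, _, B => checkTrail B l
  | split i j r b, R, B =>
    decide (i ≠ j) && check known r (s(i, j) :: R) B && check known b R (s(i, j) :: B)
  | relabel k σ, R, B => known[k]?.any fun S ↦ checkEmbedding S σ R B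
  | relabelSwap k σ, R, B => known[k]?.any fun S ↦ checkEmbedding S σ B R

theorem hasTrail_of_checkTrail {G : SimpleGraph (Fin 7)} {R : List (Sym2 (Fin 7))}
    {l : List (Fin 7)} (h : checkTrail R l) (hR : ∀ e ∈ R, e ∈ G.edgeSet) :
    HasTrailWithVertices G 10 := by
  simp only [checkTrail, Bool.and_eq_true, decide_eq_true_eq, List.all_eq_true] at h
  obtain ⟨⟨hlen, hmem⟩, hnd⟩ := h
  refine .of_stepEdges (fun e he ↦ hR e (hmem e he)) hnd (by rw [hlen]) ?_
  rintro rfl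
  simp [stepEdges] at hlen

theorem forcesTrail_of_checkEmbedding {S : List (Sym2 (Fin 7)) × List (Sym2 (Fin 7))}
    {σ : List (Fin 7)} {R B : List (Sym2 (Fin 7))} (h : checkEmbedding S σ R B)
    (hS : ForcesTrail S) : ForcesTrail (R, B) := by
  simp only [checkEmbedding, Bool.and_eq_true, decide_eq_true_eq, List.all_eq_true] at h
  exact .of_injective h.1.1 hS h.1.2 h.2

theorem forcesTrail_of_check {known : List (List (Sym2 (Fin 7)) × List (Sym2 (Fin 7)))}
    (hknown : ∀ S ∈ known, ForcesTrail S) (c : TrailCertificate) {R B : List (Sym2 (Fin 7))}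
    (h : c.check known R B) : ForcesTrail (R, B) := by
  induction c generalizing R B with
  | red l => exact fun G hR _ ↦ .inl (hasTrail_of_checkTrail h hR)
  | blue l => exact fun G _ hB ↦ .inr (hasTrail_of_checkTrail h hB)
  | split i j r b ihr ihb =>
    simp only [check, Bool.and_eq_true, decide_eq_true_eq] at h
    exact .split h.1.1 (ihr h.1.2) (ihb h.2)
  | relabel k σ =>
    obtain ⟨S, hS, h⟩ := (Option.any_eq_true _ _).1 h
    exact forcesTrail_of_checkEmbedding h (hknown S (List.mem_of_getElem? hS))
  | relabelSwap k σ =>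
    obtain ⟨S, hS, h⟩ := (Option.any_eq_true _ _).1 h
    exact (forcesTrail_of_checkEmbedding h (hknown S (List.mem_of_getElem? hS))).swap

/-- Whether every certificate in a list is valid, where each may use the colourings before it. -/
def checkAll : List (List (Sym2 (Fin 7)) × List (Sym2 (Fin 7))) →
    List ((List (Sym2 (Fin 7)) × List (Sym2 (Fin 7))) × TrailCertificate) → Bool
  | _, [] => true
  | known, (S, c) :: t => c.check known S.1 S.2 && checkAll (known ++ [S]) t

theorem forcesTrail_of_checkAll
    (t : List ((List (Sym2 (Fin 7)) × List (Sym2 (Fin 7))) × TrailCertificate))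
    {known : List (List (Sym2 (Fin 7)) × List (Sym2 (Fin 7)))}
    (hknown : ∀ S ∈ known, ForcesTrail S) (h : checkAll known t) :
    ∀ x ∈ t, ForcesTrail x.1 := by
  induction t generalizing known with
  | nil => simp
  | cons x t ih =>
    obtain ⟨S, c⟩ := x
    simp only [checkAll, Bool.and_eq_true] at h
    have hS : ForcesTrail S := forcesTrail_of_check hknown c h.1
    refine List.forall_mem_cons.2 ⟨hS, ih (known := known ++ [S]) ?_ h.2⟩
    simpa [or_imp, forall_and, hS] using fun a b ↦ hknown (a, b)

/-- Certificates for a sequence of colourings, the last of which is empty. -/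
def table : List ((List (Sym2 (Fin 7)) × List (Sym2 (Fin 7))) × TrailCertificate) := [
  (([s(0, 1), s(0, 2), s(0, 4), s(2, 4), s(3, 4), s(0, 5), s(3, 5), s(0, 6), s(2, 6)],
    [s(1, 2), s(1, 3), s(1, 4), s(1, 5), s(1, 6)]),
   (.split 2 5
    (.red [1, 0, 2, 4, 0, 6, 2, 5, 3, 4])
    (.split 4 5
     (.red [1, 0, 2, 4, 3, 5, 4, 0, 6, 2])
     (.split 5 6
      (.split 3 6
       (.red [0, 2, 6, 0, 4, 3, 6, 5, 0, 1])
       (.split 2 3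
        (.red [0, 2, 3, 5, 0, 4, 2, 6, 0, 1])
        (.split 0 3
         (.red [1, 0, 2, 4, 0, 3, 5, 0, 6, 2])
         (.blue [0, 3, 1, 2, 3, 6, 1, 4, 5, 1]))))
      (.split 2 3
       (.red [0, 2, 3, 5, 0, 4, 2, 6, 0, 1])
       (.blue [1, 2, 3, 1, 4, 5, 1, 6, 5, 2])))))),
  (([s(0, 1), s(0, 2), s(0, 4), s(3, 4), s(0, 5), s(3, 5), s(0, 6), s(2, 6)],
    []),
   (.split 1 4
    (.red [0, 1, 4, 0, 2, 6, 0, 5, 3, 4])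
    (.split 1 5
     (.red [0, 1, 5, 0, 2, 6, 0, 4, 3, 5])
     (.split 1 3
      (.red [0, 1, 3, 4, 0, 2, 6, 0, 5, 3])
      (.split 1 2
       (.red [0, 1, 2, 0, 4, 3, 5, 0, 6, 2])
       (.split 1 6
        (.red [0, 1, 6, 0, 4, 3, 5, 0, 2, 6])
        (.split 2 4
         (.relabel 0 [0, 1, 2, 3, 4, 5, 6])
         (.split 4 6
          (.relabel 0 [0, 1, 6, 3, 4, 5, 2])
          (.split 4 5
           (.split 5 6
            (.red [1, 0, 2, 6, 5, 0, 4, 3, 5, 4])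
            (.split 3 6
             (.split 2 5
              (.red [1, 0, 2, 5, 3, 4, 5, 0, 6, 2])
              (.split 2 3
               (.red [0, 2, 3, 4, 0, 5, 3, 6, 0, 1])
               (.blue [1, 2, 3, 1, 4, 2, 5, 1, 6, 4])))
             (.blue [1, 2, 4, 1, 3, 6, 1, 5, 6, 4])))
           (.split 3 6
            (.split 2 3
             (.red [0, 2, 3, 4, 0, 5, 3, 6, 0, 1])
             (.blue [1, 2, 3, 1, 4, 5, 1, 6, 4, 2]))
            (.blue [1, 2, 4, 1, 3, 6, 1, 5, 4, 6]))))))))))),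
  (([s(0, 1), s(0, 2), s(0, 4), s(3, 4), s(0, 5), s(3, 5), s(0, 6), s(3, 6)],
    [s(1, 2), s(1, 6), s(2, 6)]),
   (.split 1 3
    (.red [0, 1, 3, 4, 0, 5, 3, 6, 0, 2])
    (.split 2 3
     (.red [0, 2, 3, 4, 0, 5, 3, 6, 0, 1])
     (.split 1 5
      (.relabel 1 [0, 2, 1, 3, 4, 6, 5])
      (.split 2 4
       (.relabel 1 [0, 1, 2, 3, 5, 6, 4])
       (.split 1 4
        (.relabel 1 [0, 2, 1, 3, 5, 6, 4])
        (.split 2 5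
         (.relabel 1 [0, 1, 2, 3, 4, 6, 5])
         (.blue [1, 2, 3, 1, 4, 2, 5, 1, 6, 2])))))))),
  (([s(0, 1), s(0, 2), s(0, 4), s(3, 4), s(0, 5), s(1, 5), s(3, 5), s(0, 6), s(4, 6)],
    [s(1, 2), s(1, 4), s(2, 4), s(1, 6), s(2, 6), s(3, 6)]),
   (.split 2 5
    (.red [0, 1, 5, 0, 2, 5, 3, 4, 0, 6])
    (.split 5 6
     (.red [0, 1, 5, 0, 4, 3, 5, 6, 0, 2])
     (.split 2 3
      (.red [0, 1, 5, 0, 2, 3, 4, 0, 6, 4])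
      (.blue [1, 2, 3, 6, 1, 4, 2, 5, 6, 2]))))),
  (([s(0, 1), s(0, 2), s(0, 4), s(3, 4), s(0, 5), s(3, 5), s(0, 6), s(4, 6)],
    [s(1, 2), s(1, 6), s(2, 6), s(3, 6)]),
   (.split 1 4
    (.red [0, 1, 4, 0, 5, 3, 4, 6, 0, 2])
    (.split 2 4
     (.red [0, 2, 4, 0, 5, 3, 4, 6, 0, 1])
     (.split 1 5
      (.relabel 3 [0, 1, 2, 3, 4, 5, 6])
      (.split 2 5
       (.relabel 3 [0, 2, 1, 3, 4, 5, 6])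
       (.split 1 3
        (.relabel 2 [0, 2, 6, 3, 4, 5, 1])
        (.blue [1, 2, 4, 1, 3, 6, 1, 5, 2, 6]))))))),
  (([s(0, 1), s(0, 2), s(0, 4), s(3, 4), s(0, 5), s(3, 5), s(0, 6)],
    []),
   (.split 2 6
    (.relabel 1 [0, 1, 2, 3, 4, 5, 6])
    (.split 1 2
     (.relabel 1 [0, 6, 1, 3, 4, 5, 2])
     (.split 1 6
      (.relabel 1 [0, 2, 1, 3, 4, 5, 6])
      (.split 3 6
       (.relabel 2 [0, 1, 2, 3, 4, 5, 6])
       (.split 4 6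
        (.relabel 4 [0, 1, 2, 3, 4, 5, 6])
        (.split 5 6
         (.relabel 4 [0, 1, 2, 3, 5, 4, 6])
         (.split 2 3
          (.relabel 2 [0, 1, 6, 3, 4, 5, 2])
          (.split 2 5
           (.relabel 4 [0, 1, 6, 3, 5, 4, 2])
           (.split 2 4
            (.relabel 4 [0, 1, 6, 3, 4, 5, 2])
            (.blue [2, 1, 6, 2, 3, 6, 4, 2, 5, 6]))))))))))),
  (([s(0, 1), s(0, 2), s(1, 2), s(0, 4), s(1, 4), s(2, 4), s(3, 4), s(0, 5)],
    [s(1, 3), s(2, 3), s(3, 5), s(1, 6), s(2, 6), s(3, 6), s(5, 6)]),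
   (.split 1 5
    (.red [2, 0, 1, 2, 4, 0, 5, 1, 4, 3])
    (.split 2 5
     (.red [1, 0, 2, 1, 4, 0, 5, 2, 4, 3])
     (.blue [1, 3, 2, 5, 1, 6, 3, 5, 6, 2])))),
  (([s(0, 1), s(0, 2), s(0, 4), s(1, 4), s(2, 4), s(3, 4), s(0, 5), s(4, 5), s(0, 6)],
    [s(1, 3), s(2, 3), s(3, 5), s(3, 6)]),
   (.split 1 6
    (.red [0, 1, 4, 0, 2, 4, 5, 0, 6, 1])
    (.split 2 6
     (.red [0, 1, 4, 0, 2, 4, 5, 0, 6, 2])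
     (.split 5 6
      (.red [0, 1, 4, 0, 5, 6, 0, 2, 4, 3])
      (.split 1 2
       (.relabel 6 [0, 1, 2, 3, 4, 5, 6])
       (.split 1 5
        (.relabel 6 [0, 1, 5, 3, 4, 2, 6])
        (.blue [2, 1, 3, 2, 6, 1, 5, 3, 6, 5]))))))),
  (([s(0, 1), s(0, 2), s(0, 4), s(1, 4), s(2, 4), s(3, 4), s(0, 5), s(0, 6), s(1, 6)],
    [s(1, 3), s(2, 3), s(3, 5), s(4, 5), s(3, 6), s(4, 6), s(5, 6)]),
   (.split 1 5
    (.red [3, 4, 0, 1, 4, 2, 0, 5, 1, 6])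
    (.split 2 5
     (.red [1, 0, 4, 1, 6, 0, 5, 2, 4, 3])
     (.blue [5, 1, 3, 2, 5, 3, 6, 4, 5, 6])))),
  (([s(0, 1), s(0, 2), s(0, 4), s(1, 4), s(2, 4), s(3, 4), s(0, 5), s(0, 6)],
    [s(1, 3), s(2, 3), s(3, 5), s(3, 6)]),
   (.split 4 5
    (.relabel 7 [0, 1, 2, 3, 4, 5, 6])
    (.split 4 6
     (.relabel 7 [0, 1, 2, 3, 4, 6, 5])
     (.split 5 6
      (.red [0, 1, 4, 0, 5, 6, 0, 2, 4, 3])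
      (.split 1 6
       (.relabel 8 [0, 1, 2, 3, 4, 5, 6])
       (.split 2 6
        (.relabel 8 [0, 2, 1, 3, 4, 5, 6])
        (.blue [5, 3, 1, 6, 2, 3, 6, 4, 5, 6]))))))),
  (([s(0, 1), s(0, 2), s(0, 4), s(1, 4), s(3, 4), s(0, 5), s(2, 5), s(0, 6)],
    [s(1, 3), s(2, 3), s(2, 4), s(3, 5), s(4, 5), s(3, 6), s(5, 6)]),
   (.split 1 5
    (.split 1 6
     (.red [3, 4, 0, 1, 5, 2, 0, 6, 1, 4])
     (.split 4 6
      (.red [0, 1, 4, 0, 2, 5, 0, 6, 4, 3])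
      (.blue [4, 2, 3, 1, 6, 3, 5, 4, 6, 5])))
    (.split 0 3
     (.red [4, 0, 1, 4, 3, 0, 2, 5, 0, 6])
     (.blue [0, 3, 1, 5, 3, 2, 4, 5, 6, 3])))),
  (([s(0, 1), s(0, 2), s(0, 4), s(1, 4), s(3, 4), s(0, 5), s(0, 6)],
    [s(1, 3), s(2, 3), s(3, 5), s(3, 6)]),
   (.split 2 4
    (.relabel 9 [0, 1, 2, 3, 4, 5, 6])
    (.split 4 5
     (.relabel 9 [0, 1, 5, 3, 4, 2, 6])
     (.split 2 5
      (.split 2 6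
       (.split 5 6
        (.split 1 6
         (.red [0, 1, 4, 0, 2, 6, 0, 5, 6, 1])
         (.split 1 5
          (.red [0, 1, 4, 0, 2, 5, 0, 6, 5, 1])
          (.split 1 2
           (.red [0, 1, 2, 0, 5, 2, 6, 0, 4, 1])
           (.blue [2, 1, 3, 2, 4, 5, 1, 6, 3, 5]))))
        (.relabel 10 [0, 1, 2, 3, 4, 5, 6]))
       (.relabel 10 [0, 1, 5, 3, 4, 2, 6]))
      (.split 1 2
       (.split 1 5
        (.split 1 6
         (.red [0, 1, 2, 0, 4, 1, 5, 0, 6, 1])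
         (.split 2 6
          (.red [0, 1, 2, 0, 4, 1, 5, 0, 6, 2])
          (.blue [5, 2, 3, 1, 6, 2, 4, 5, 3, 6])))
        (.split 5 6
         (.split 1 6
          (.red [3, 4, 0, 1, 2, 0, 5, 6, 1, 4])
          (.blue [1, 3, 2, 4, 5, 1, 6, 3, 5, 2]))
         (.blue [2, 3, 1, 5, 2, 4, 5, 3, 6, 5])))
       (.split 2 6
        (.split 5 6
         (.split 4 6
          (.red [3, 4, 0, 1, 4, 6, 2, 0, 5, 6])
          (.blue [4, 2, 1, 3, 2, 5, 3, 6, 4, 5]))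
         (.blue [1, 2, 3, 5, 2, 4, 5, 6, 3, 1]))
        (.blue [2, 1, 3, 2, 4, 5, 2, 6, 3, 5]))))))),
  (([s(0, 1), s(0, 2), s(0, 4), s(3, 4), s(0, 5), s(0, 6), s(1, 6)],
    [s(1, 3), s(2, 3), s(1, 4), s(2, 5), s(3, 5), s(3, 6), s(5, 6)]),
   (.split 4 5
    (.relabel 11 [0, 5, 1, 3, 4, 2, 6])
    (.split 1 5
     (.split 0 3
      (.red [1, 0, 3, 4, 0, 5, 1, 6, 0, 2])
      (.blue [0, 3, 1, 4, 5, 2, 3, 5, 6, 3]))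
     (.blue [1, 3, 2, 5, 1, 4, 5, 3, 6, 5])))),
  (([s(0, 1), s(0, 2), s(0, 4), s(3, 4), s(0, 5), s(0, 6), s(1, 6), s(2, 6)],
    [s(1, 3), s(2, 3), s(1, 4), s(3, 5), s(3, 6)]),
   (.split 5 6
    (.red [0, 1, 6, 0, 2, 6, 5, 0, 4, 3])
    (.split 2 5
     (.split 1 2
      (.red [0, 1, 2, 0, 5, 2, 6, 0, 4, 3])
      (.split 1 5
       (.split 4 5
        (.red [0, 1, 5, 0, 2, 5, 4, 0, 6, 1])
        (.split 4 6
         (.red [0, 1, 5, 0, 2, 6, 0, 4, 6, 1])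
         (.split 2 4
          (.red [3, 4, 0, 1, 5, 2, 0, 6, 2, 4])
          (.blue [1, 2, 3, 1, 4, 5, 3, 6, 4, 2]))))
       (.split 4 6
        (.red [0, 1, 6, 0, 2, 5, 0, 4, 6, 2])
        (.blue [5, 1, 2, 3, 1, 4, 6, 3, 5, 6]))))
     (.relabel 12 [0, 1, 2, 3, 4, 5, 6])))),
  (([s(0, 1), s(0, 2), s(0, 4), s(3, 4), s(0, 5), s(0, 6), s(1, 6)],
    [s(1, 3), s(2, 3), s(1, 4), s(3, 5), s(3, 6)]),
   (.split 2 6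
    (.relabel 13 [0, 1, 2, 3, 4, 5, 6])
    (.split 2 4
     (.relabel 11 [0, 2, 1, 3, 4, 5, 6])
     (.split 2 5
      (.split 5 6
       (.relabel 13 [0, 1, 5, 3, 4, 2, 6])
       (.split 1 2
        (.relabel 13 [0, 1, 5, 3, 4, 6, 2])
        (.blue [1, 2, 3, 1, 4, 2, 6, 3, 5, 6])))
      (.relabel 12 [0, 1, 5, 3, 4, 2, 6]))))),
  (([s(0, 1), s(0, 2), s(0, 4), s(3, 4), s(0, 5), s(0, 6)],
    []),
   (.split 3 5
    (.relabel 5 [0, 1, 2, 3, 4, 5, 6])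
    (.split 1 3
     (.relabel 5 [0, 2, 5, 3, 1, 4, 6])
     (.split 3 6
      (.relabel 5 [0, 1, 2, 3, 4, 6, 5])
      (.split 2 3
       (.relabel 5 [0, 1, 5, 3, 2, 4, 6])
       (.split 1 4
        (.relabel 11 [0, 1, 2, 3, 4, 5, 6])
        (.split 1 6
         (.relabel 14 [0, 1, 2, 3, 4, 5, 6])
         (.split 1 5
          (.relabel 14 [0, 1, 2, 3, 4, 6, 5])
          (.split 1 2
           (.relabel 14 [0, 1, 5, 3, 4, 6, 2])
           (.split 4 6
            (.relabel 11 [0, 6, 1, 3, 4, 2, 5])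
            (.blue [1, 2, 3, 1, 4, 6, 1, 5, 3, 6]))))))))))),
  (([s(0, 1), s(0, 2), s(3, 4), s(0, 5), s(0, 6), s(1, 6), s(3, 6), s(4, 6)],
    [s(0, 3)]),
   (.split 5 6
    (.red [2, 0, 1, 6, 0, 5, 6, 3, 4, 6])
    (.split 2 5
     (.red [0, 1, 6, 3, 4, 6, 0, 2, 5, 0])
     (.split 1 5
      (.red [1, 0, 5, 1, 6, 3, 4, 6, 0, 2])
      (.split 3 5
       (.red [2, 0, 1, 6, 0, 5, 3, 4, 6, 3])
       (.split 4 5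
        (.red [2, 0, 1, 6, 0, 5, 4, 3, 6, 4])
        (.relabelSwap 15 [5, 1, 2, 0, 3, 4, 6]))))))),
  (([s(0, 1), s(0, 2), s(1, 2), s(3, 4), s(0, 5), s(0, 6), s(3, 6), s(4, 6)],
    [s(0, 3)]),
   (.split 5 6
    (.red [0, 1, 2, 0, 5, 6, 3, 4, 6, 0])
    (.split 2 5
     (.red [2, 0, 1, 2, 5, 0, 6, 3, 4, 6])
     (.split 1 5
      (.red [1, 0, 2, 1, 5, 0, 6, 3, 4, 6])
      (.split 4 5
       (.red [4, 3, 6, 0, 1, 2, 0, 5, 4, 6])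
       (.split 3 5
        (.red [3, 4, 6, 0, 1, 2, 0, 5, 3, 6])
        (.relabelSwap 15 [5, 1, 2, 0, 3, 4, 6]))))))),
  (([s(0, 1), s(0, 2), s(1, 3), s(3, 4), s(0, 5), s(0, 6), s(3, 6), s(4, 6)],
    [s(1, 2), s(0, 3), s(0, 4), s(1, 5), s(1, 6), s(2, 6)]),
   (.split 2 3
    (.red [5, 0, 1, 3, 2, 0, 6, 3, 4, 6])
    (.split 2 5
     (.red [3, 1, 0, 2, 5, 0, 6, 3, 4, 6])
     (.split 2 4
      (.split 4 5
       (.red [3, 1, 0, 2, 4, 3, 6, 0, 5, 4])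
       (.blue [1, 2, 3, 0, 4, 5, 1, 6, 2, 5]))
      (.blue [1, 2, 3, 0, 4, 2, 5, 1, 6, 2]))))),
  (([s(0, 1), s(0, 2), s(2, 3), s(3, 4), s(0, 5), s(1, 5), s(0, 6), s(4, 6)],
    [s(0, 3), s(0, 4), s(3, 6)]),
   (.split 3 5
    (.red [3, 2, 0, 1, 5, 0, 6, 4, 3, 5])
    (.split 1 3
     (.red [1, 0, 2, 3, 1, 5, 0, 6, 4, 3])
     (.split 2 4
      (.red [2, 0, 1, 5, 0, 6, 4, 2, 3, 4])
      (.split 2 5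
       (.red [2, 0, 1, 5, 0, 6, 4, 3, 2, 5])
       (.split 1 6
        (.red [1, 0, 2, 3, 4, 6, 0, 5, 1, 6])
        (.split 1 4
         (.red [1, 0, 2, 3, 4, 1, 5, 0, 6, 4])
         (.blue [1, 3, 0, 4, 1, 6, 3, 5, 2, 4])))))))),
  (([s(0, 1), s(0, 2), s(2, 3), s(3, 4), s(0, 5), s(2, 5), s(0, 6), s(4, 6)],
    [s(0, 3), s(1, 5)]),
   (.split 1 2
    (.red [0, 1, 2, 0, 5, 2, 3, 4, 6, 0])
    (.split 1 3
     (.red [2, 0, 1, 3, 2, 5, 0, 6, 4, 3])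
     (.split 1 4
      (.red [2, 0, 1, 4, 3, 2, 5, 0, 6, 4])
      (.split 1 6
       (.red [2, 0, 1, 6, 0, 5, 2, 3, 4, 6])
       (.relabelSwap 15 [1, 2, 4, 0, 3, 5, 6])))))),
  (([s(0, 1), s(0, 2), s(2, 3), s(3, 4), s(0, 5), s(0, 6), s(4, 6)],
    [s(0, 3), s(0, 4), s(3, 6)]),
   (.split 1 5
    (.relabel 19 [0, 1, 2, 3, 4, 5, 6])
    (.split 2 5
     (.relabel 20 [0, 1, 2, 3, 4, 5, 6])
     (.split 4 5
      (.split 1 4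
       (.red [0, 1, 4, 3, 2, 0, 5, 4, 6, 0])
       (.split 1 2
        (.red [2, 0, 1, 2, 3, 4, 5, 0, 6, 4])
        (.split 1 6
         (.red [4, 3, 2, 0, 1, 6, 0, 5, 4, 6])
         (.split 1 3
          (.red [3, 1, 0, 2, 3, 4, 5, 0, 6, 4])
          (.blue [1, 2, 5, 1, 3, 0, 4, 1, 6, 3])))))
      (.split 5 6
       (.relabel 20 [0, 1, 6, 4, 3, 5, 2])
       (.split 3 5
        (.split 1 2
         (.red [2, 0, 1, 2, 3, 4, 6, 0, 5, 3])
         (.relabelSwap 19 [5, 1, 4, 0, 3, 2, 6]))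
        (.relabelSwap 15 [5, 1, 2, 0, 3, 4, 6]))))))),
  (([s(0, 1), s(0, 2), s(3, 4), s(0, 5), s(0, 6), s(4, 6)],
    [s(0, 3), s(0, 4)]),
   (.split 3 6
    (.split 1 6
     (.relabel 16 [0, 1, 2, 3, 4, 5, 6])
     (.split 1 2
      (.relabel 17 [0, 1, 2, 3, 4, 5, 6])
      (.split 2 6
       (.relabel 16 [0, 2, 1, 3, 4, 5, 6])
       (.split 1 5
        (.relabel 17 [0, 1, 5, 3, 4, 2, 6])
        (.split 1 3
         (.relabel 18 [0, 1, 2, 3, 4, 5, 6])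
         (.split 1 4
          (.relabel 18 [0, 1, 2, 4, 3, 5, 6])
          (.relabelSwap 15 [1, 2, 3, 0, 4, 5, 6])))))))
    (.split 2 3
     (.relabel 21 [0, 1, 2, 3, 4, 5, 6])
     (.split 3 5
      (.relabel 21 [0, 1, 5, 3, 4, 2, 6])
      (.split 1 3
       (.relabel 21 [0, 2, 1, 3, 4, 5, 6])
       (.relabelSwap 15 [3, 1, 2, 4, 0, 5, 6])))))),
  (([s(0, 1), s(0, 2), s(3, 4), s(0, 5), s(0, 6)],
    []),
   (.split 0 4
    (.relabel 15 [0, 1, 2, 3, 4, 5, 6])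
    (.split 0 3
     (.relabel 15 [0, 1, 2, 4, 3, 5, 6])
     (.split 4 6
      (.relabel 22 [0, 1, 2, 3, 4, 5, 6])
      (.split 1 4
       (.relabel 22 [0, 2, 5, 3, 4, 6, 1])
       (.split 2 4
        (.relabel 22 [0, 1, 5, 3, 4, 6, 2])
        (.split 4 5
         (.relabel 22 [0, 1, 2, 3, 4, 6, 5])
         (.relabelSwap 15 [4, 1, 2, 3, 0, 5, 6])))))))),
  (([s(0, 1), s(0, 2), s(2, 3), s(1, 4), s(0, 5), s(3, 5), s(4, 5), s(0, 6)],
    [s(0, 4)]),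
   (.split 5 6
    (.red [0, 1, 4, 5, 0, 2, 3, 5, 6, 0])
    (.split 3 6
     (.red [3, 2, 0, 1, 4, 5, 0, 6, 3, 5])
     (.split 2 6
      (.red [2, 0, 1, 4, 5, 0, 6, 2, 3, 5])
      (.split 1 6
       (.red [1, 0, 2, 3, 5, 0, 6, 1, 4, 5])
       (.relabelSwap 23 [6, 1, 2, 0, 4, 3, 5])))))),
  (([s(0, 1), s(0, 2), s(2, 3), s(0, 5), s(3, 5), s(4, 5), s(0, 6)],
    [s(0, 3), s(0, 4), s(3, 4)]),
   (.split 1 4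
    (.relabel 24 [0, 1, 2, 3, 4, 5, 6])
    (.split 2 4
     (.split 1 2
      (.red [5, 0, 1, 2, 3, 5, 4, 2, 0, 6])
      (.split 1 5
       (.red [2, 0, 1, 5, 3, 2, 4, 5, 0, 6])
       (.split 1 6
        (.red [2, 0, 1, 6, 0, 5, 3, 2, 4, 5])
        (.relabelSwap 23 [1, 2, 4, 0, 3, 5, 6]))))
     (.split 1 5
      (.split 5 6
       (.red [4, 5, 0, 1, 5, 3, 2, 0, 6, 5])
       (.relabelSwap 23 [4, 0, 1, 5, 6, 2, 3]))
      (.split 4 6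
       (.relabel 24 [0, 2, 6, 4, 3, 5, 1])
       (.relabelSwap 23 [4, 0, 2, 1, 5, 3, 6])))))),
  (([s(0, 1), s(0, 2), s(0, 5), s(3, 5), s(4, 5), s(0, 6)],
    [s(3, 4)]),
   (.split 0 4
    (.relabel 23 [0, 1, 2, 3, 5, 4, 6])
    (.split 0 3
     (.relabel 23 [0, 1, 2, 4, 5, 3, 6])
     (.split 2 3
      (.relabel 25 [0, 1, 2, 3, 4, 5, 6])
      (.split 3 6
       (.relabel 25 [0, 1, 6, 3, 4, 5, 2])
       (.split 1 3
        (.relabel 25 [0, 2, 1, 3, 4, 5, 6])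
        (.split 1 4
         (.relabel 25 [0, 2, 1, 4, 3, 5, 6])
         (.split 4 6
          (.relabel 25 [0, 1, 6, 4, 3, 5, 2])
          (.split 2 4
           (.relabel 25 [0, 1, 2, 4, 3, 5, 6])
           (.blue [3, 0, 4, 1, 3, 2, 4, 3, 6, 4])))))))))),
  (([s(0, 1), s(0, 2), s(2, 4), s(0, 5), s(4, 5), s(0, 6), s(1, 6), s(2, 6)],
    [s(0, 3), s(3, 4), s(3, 5)]),
   (.split 1 2
    (.red [1, 0, 2, 1, 6, 0, 5, 4, 2, 6])
    (.split 3 6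
     (.red [2, 0, 1, 6, 0, 5, 4, 2, 6, 3])
     (.relabelSwap 23 [3, 0, 4, 1, 2, 5, 6])))),
  (([s(0, 1), s(0, 2), s(2, 4), s(0, 5), s(4, 5), s(0, 6)],
    [s(0, 3), s(3, 4), s(3, 5)]),
   (.split 2 3
    (.relabel 26 [0, 1, 5, 3, 4, 2, 6])
    (.split 1 6
     (.split 1 5
      (.relabel 27 [0, 6, 5, 3, 4, 2, 1])
      (.split 5 6
       (.relabel 27 [0, 1, 5, 3, 4, 2, 6])
       (.relabelSwap 26 [3, 0, 2, 1, 6, 5, 4])))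
     (.relabelSwap 23 [3, 0, 2, 1, 6, 4, 5])))),
  (([s(0, 1), s(0, 2), s(0, 5), s(4, 5), s(0, 6)],
    [s(3, 4)]),
   (.split 3 5
    (.relabel 26 [0, 1, 2, 3, 4, 5, 6])
    (.split 0 3
     (.relabel 23 [0, 1, 2, 4, 5, 3, 6])
     (.split 2 4
      (.relabel 28 [0, 1, 2, 3, 4, 5, 6])
      (.split 4 6
       (.relabel 28 [0, 1, 6, 3, 4, 5, 2])
       (.split 1 4
        (.relabel 28 [0, 2, 1, 3, 4, 5, 6])
        (.relabelSwap 26 [4, 1, 2, 0, 5, 3, 6]))))))),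
  (([s(0, 1), s(0, 2), s(0, 5), s(0, 6)],
    []),
   (.split 3 4
    (.relabel 23 [0, 1, 2, 3, 4, 5, 6])
    (.split 4 5
     (.relabel 29 [0, 1, 2, 3, 4, 5, 6])
     (.split 2 3
      (.relabel 29 [0, 1, 5, 4, 3, 2, 6])
      (.split 1 3
       (.relabel 29 [0, 2, 5, 4, 3, 1, 6])
       (.split 3 6
        (.relabel 29 [0, 1, 2, 4, 3, 6, 5])
        (.relabelSwap 29 [3, 1, 2, 0, 5, 4, 6]))))))),
  (([s(0, 1), s(0, 2), s(1, 3), s(1, 4), s(3, 5), s(0, 6), s(2, 6), s(5, 6)],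
    [s(1, 2), s(0, 3), s(0, 5), s(1, 5)]),
   (.split 4 6
    (.red [0, 1, 3, 5, 6, 0, 2, 6, 4, 1])
    (.split 3 6
     (.relabel 30 [6, 0, 2, 1, 4, 3, 5])
     (.split 4 5
      (.split 3 4
       (.split 2 4
        (.red [0, 1, 4, 3, 5, 4, 2, 0, 6, 2])
        (.split 2 3
         (.red [0, 1, 3, 4, 5, 3, 2, 0, 6, 2])
         (.split 2 5
          (.red [0, 1, 3, 5, 2, 0, 6, 5, 4, 1])
          (.blue [3, 0, 5, 1, 2, 3, 6, 4, 2, 5]))))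
       (.split 2 3
        (.split 2 4
         (.red [0, 1, 3, 2, 0, 6, 2, 4, 5, 3])
         (.split 0 4
          (.red [2, 0, 1, 3, 2, 6, 0, 4, 5, 3])
          (.blue [0, 3, 4, 0, 5, 1, 2, 4, 6, 3])))
        (.relabelSwap 30 [3, 0, 2, 1, 5, 4, 6])))
      (.split 0 4
       (.red [1, 0, 2, 6, 0, 4, 1, 3, 5, 6])
       (.split 2 4
        (.split 2 5
         (.red [0, 1, 3, 5, 2, 0, 6, 2, 4, 1])
         (.blue [0, 3, 6, 4, 0, 5, 1, 2, 5, 4]))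
        (.blue [0, 3, 6, 4, 0, 5, 1, 2, 4, 5]))))))),
  (([s(0, 1), s(0, 2), s(1, 3), s(2, 3), s(3, 5), s(0, 6), s(4, 6)],
    [s(3, 4), s(0, 5), s(1, 5), s(4, 5)]),
   (.split 2 5
    (.split 2 4
     (.red [0, 1, 3, 2, 0, 6, 4, 2, 5, 3])
     (.split 0 4
      (.red [2, 0, 4, 6, 0, 1, 3, 2, 5, 3])
      (.relabelSwap 30 [4, 0, 2, 1, 6, 3, 5])))
    (.relabelSwap 30 [5, 0, 1, 3, 6, 2, 4]))),
  (([s(0, 1), s(0, 2), s(1, 3), s(1, 4), s(3, 5), s(0, 6), s(5, 6)],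
    [s(0, 3), s(0, 5), s(1, 5)]),
   (.split 1 2
    (.relabel 30 [1, 0, 2, 5, 6, 3, 4])
    (.split 2 6
     (.relabel 31 [0, 1, 2, 3, 4, 5, 6])
     (.split 2 3
      (.split 3 4
       (.red [0, 1, 3, 2, 0, 6, 5, 3, 4, 1])
       (.split 4 5
        (.split 2 5
         (.red [0, 1, 3, 5, 2, 0, 6, 5, 4, 1])
         (.split 2 4
          (.split 4 6
           (.red [0, 1, 3, 5, 4, 2, 0, 6, 4, 1])
           (.split 3 6
            (.red [0, 1, 3, 2, 0, 6, 3, 5, 4, 1])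
            (.relabelSwap 31 [6, 2, 4, 5, 1, 0, 3])))
          (.relabelSwap 30 [2, 1, 4, 0, 3, 5, 6])))
        (.split 4 6
         (.relabel 32 [0, 1, 2, 3, 4, 5, 6])
         (.split 0 4
          (.red [1, 0, 2, 3, 1, 4, 0, 6, 5, 3])
          (.blue [0, 3, 4, 0, 5, 1, 2, 6, 4, 5])))))
      (.split 4 5
       (.split 2 5
        (.red [0, 1, 3, 5, 2, 0, 6, 5, 4, 1])
        (.relabelSwap 30 [2, 1, 3, 0, 4, 5, 6]))
       (.split 2 5
        (.split 3 4
         (.relabel 31 [3, 5, 4, 2, 6, 0, 1])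
         (.relabel 32 [0, 2, 6, 5, 4, 3, 1]))
        (.relabelSwap 30 [2, 1, 3, 0, 4, 5, 6]))))))),
  (([s(0, 1), s(0, 2), s(1, 3), s(1, 4), s(3, 5), s(0, 6)],
    [s(0, 3), s(0, 5)]),
   (.split 1 5
    (.relabel 30 [1, 0, 3, 2, 6, 4, 5])
    (.split 5 6
     (.relabel 33 [0, 1, 2, 3, 4, 5, 6])
     (.split 2 5
      (.relabel 33 [0, 1, 6, 3, 4, 5, 2])
      (.relabelSwap 30 [5, 0, 1, 3, 4, 2, 6]))))),
  (([s(0, 1), s(0, 2), s(1, 4), s(3, 5), s(0, 6)],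
    [s(0, 3), s(0, 5), s(2, 5), s(5, 6)]),
   (.split 1 5
    (.relabel 34 [0, 1, 2, 5, 4, 3, 6])
    (.relabelSwap 30 [5, 0, 1, 3, 4, 2, 6]))),
  (([s(0, 1), s(0, 2), s(2, 3), s(1, 4), s(3, 5), s(0, 6)],
    [s(0, 3), s(1, 3), s(0, 5)]),
   (.split 2 5
    (.split 2 4
     (.relabel 34 [0, 2, 1, 3, 4, 5, 6])
     (.split 2 6
      (.relabel 30 [2, 0, 3, 1, 4, 5, 6])
      (.split 4 6
       (.relabel 34 [2, 0, 3, 6, 1, 4, 5])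
       (.split 1 6
        (.split 1 5
         (.relabel 34 [0, 1, 2, 5, 4, 3, 6])
         (.split 0 4
          (.red [1, 0, 4, 1, 6, 0, 2, 3, 5, 2])
          (.split 3 4
           (.relabel 34 [0, 2, 1, 3, 5, 4, 6])
           (.blue [0, 3, 1, 5, 0, 4, 2, 6, 4, 3]))))
        (.split 5 6
         (.split 4 5
          (.red [0, 1, 4, 5, 2, 0, 6, 5, 3, 2])
          (.split 0 4
           (.red [2, 0, 1, 4, 0, 6, 5, 2, 3, 5])
           (.blue [0, 3, 1, 6, 2, 4, 0, 5, 4, 6])))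
         (.relabelSwap 30 [6, 1, 2, 0, 3, 4, 5]))))))
    (.split 5 6
     (.split 4 6
      (.relabel 34 [0, 6, 1, 5, 4, 3, 2])
      (.split 2 4
       (.relabel 34 [0, 2, 1, 3, 4, 5, 6])
       (.split 0 4
        (.relabel 30 [0, 1, 2, 3, 5, 4, 6])
        (.split 3 4
         (.relabelSwap 34 [4, 0, 2, 3, 5, 1, 6])
         (.relabelSwap 34 [3, 4, 0, 2, 6, 5, 1])))))
     (.relabel 35 [0, 1, 2, 3, 4, 5, 6])))),
  (([s(0, 1), s(0, 2), s(1, 4), s(3, 5), s(0, 6)],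
    [s(0, 3), s(0, 5)]),
   (.split 1 3
    (.relabel 34 [0, 1, 2, 3, 4, 5, 6])
    (.split 2 3
     (.relabel 36 [0, 1, 2, 3, 4, 5, 6])
     (.split 3 6
      (.relabel 36 [0, 1, 6, 3, 4, 5, 2])
      (.relabel 35 [0, 1, 2, 5, 4, 3, 6]))))),
  (([s(0, 1), s(0, 2), s(3, 5), s(0, 6)],
    [s(0, 3), s(0, 5)]),
   (.split 1 4
    (.relabel 37 [0, 1, 2, 3, 4, 5, 6])
    (.split 2 4
     (.relabel 37 [0, 2, 1, 3, 4, 5, 6])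
     (.split 4 6
      (.relabel 37 [0, 6, 1, 3, 4, 5, 2])
      (.split 0 4
       (.relabel 30 [0, 1, 2, 3, 5, 4, 6])
       (.relabelSwap 30 [4, 0, 1, 3, 5, 2, 6])))))),
  (([s(0, 1), s(0, 2), s(0, 6)],
    [s(0, 3), s(0, 5), s(1, 6)]),
   (.split 0 4
    (.relabel 30 [0, 1, 2, 3, 5, 4, 6])
    (.relabelSwap 38 [0, 3, 4, 1, 2, 6, 5]))),
  (([s(0, 6)],
    [s(0, 5), s(3, 5), s(5, 6)]),
   (.split 1 5
    (.split 2 5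
     (.relabelSwap 39 [5, 0, 3, 1, 4, 2, 6])
     (.relabelSwap 30 [5, 0, 2, 1, 4, 3, 6]))
    (.relabelSwap 30 [5, 0, 1, 2, 4, 3, 6]))),
  (([s(0, 1), s(0, 2), s(0, 6)],
    []),
   (.split 0 5
    (.relabel 30 [0, 1, 2, 3, 4, 5, 6])
    (.split 0 3
     (.relabel 30 [0, 1, 2, 4, 5, 3, 6])
     (.split 3 5
      (.relabel 38 [0, 1, 2, 3, 4, 5, 6])
      (.split 3 6
       (.split 5 6
        (.split 1 6
         (.relabel 30 [6, 0, 1, 2, 4, 3, 5])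
         (.relabel 39 [0, 1, 2, 3, 4, 5, 6]))
        (.relabel 40 [0, 1, 2, 3, 4, 5, 6]))
       (.relabel 40 [0, 1, 2, 5, 4, 3, 6])))))),
  (([s(3, 4), s(4, 5)],
    [s(0, 4), s(1, 4)]),
   (.split 2 4
    (.relabel 41 [4, 2, 3, 0, 1, 6, 5])
    (.relabelSwap 41 [4, 0, 1, 3, 5, 6, 2]))),
  (([s(0, 1), s(0, 2)],
    []),
   (.split 0 6
    (.relabel 41 [0, 1, 2, 3, 4, 5, 6])
    (.split 0 3
     (.relabel 41 [0, 1, 2, 4, 5, 6, 3])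
     (.relabel 42 [3, 6, 4, 1, 0, 2, 5])))),
  (([s(0, 1)],
    []),
   (.split 0 2
    (.relabel 43 [0, 1, 2, 3, 4, 5, 6])
    (.split 1 2
     (.relabel 43 [1, 0, 2, 3, 4, 5, 6])
     (.relabelSwap 43 [2, 0, 1, 3, 4, 5, 6])))),
  (([],
    []),
   (.split 0 1
    (.relabel 44 [0, 1, 2, 3, 4, 5, 6])
    (.relabelSwap 44 [0, 1, 2, 3, 4, 5, 6])))]

theorem checkAll_table : checkAll [] table = true := by
  decide +kernel

theorem nil_mem_table : ∃ x ∈ table, x.1 = ([], []) :=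
  ⟨_, List.getLast_mem (List.cons_ne_nil _ _), rfl⟩

end TrailCertificate

/-- For every simple graph `G` on 7 vertices, either `G` or its complement contains
a trail with 10 vertices. -/
theorem trail10_of_seven_vertices (G : SimpleGraph (Fin 7)) :
    HasTrailWithVertices G 10 ∨ HasTrailWithVertices Gᶜ 10 := by
  obtain ⟨x, hx, h⟩ := TrailCertificate.nil_mem_table
  have hG := TrailCertificate.forcesTrail_of_checkAll _ (by simp)
    TrailCertificate.checkAll_table x hx
  rw [h] at hG
  exact hG G (by simp) (by simp)
end

section
/- Let k ≥ 7 be an integer and let n be a natural number with n(n−1)/2 ∈ {2k − 3, 2k − 2} (so n > 5). Let C be a Hamiltonian cycle of the complete graph K_n. Then K_n contains a subgraph S with exactly k + 1 edges that contains all edges of C and that admits a trail using every edge of S exactly once (an Eulerian trail or Eulerian circuit of S). -/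
namespace SimpleGraph.Walk

/-- A sequence of successively adjacent vertices gives a walk with the expected edges. -/
theorem exists_edges_eq_map_range {V : Type*} {G : SimpleGraph V} (f : ℕ → V) (m : ℕ)
    (hf : ∀ i < m, G.Adj (f i) (f (i + 1))) :
    ∃ p : G.Walk (f 0) (f m), p.edges = (List.range m).map fun i => s(f i, f (i + 1)) := by
  induction m with
  | zero => exact ⟨nil, rfl⟩
  | succ m ih =>
    obtain ⟨p, hp⟩ := ih fun i hi => hf i (by lia)
    refine ⟨p.concat (hf m (by lia)), ?_⟩
    simp [edges_concat, hp, List.range_succ, List.concat_eq_append]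

/-- The edges of a trail form a graph in which the trail is Eulerian. -/
theorem IsTrail.exists_isEulerian {V : Type*} [DecidableEq V] {G : SimpleGraph V} {u v : V}
    {p : G.Walk u v} (hp : p.IsTrail) :
    ∃ S : SimpleGraph V, S.edgeSet.ncard = p.length ∧ (∀ e ∈ p.edges, e ∈ S.edgeSet) ∧
      ∃ q : S.Walk u v, q.IsEulerian := by
  have hS : (fromEdgeSet {e | e ∈ p.edges}).edgeSet = {e | e ∈ p.edges} := by
    rw [edgeSet_fromEdgeSet, sdiff_eq_left, Set.disjoint_left]
    intro e he hd
    exact G.not_isDiag_of_mem_edgeSet (p.edges_subset_edgeSet he) hd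
  have hmem : ∀ e ∈ p.edges, e ∈ (fromEdgeSet {e | e ∈ p.edges}).edgeSet := by
    simp [hS]
  refine ⟨fromEdgeSet {e | e ∈ p.edges}, ?_, hmem, p.transfer _ hmem, ?_⟩
  · have : {e | e ∈ p.edges} = (p.edges.toFinset : Set (Sym2 V)) := by ext; simp
    rw [hS, this, Set.ncard_coe_finset, List.toFinset_card_of_nodup hp.edges_nodup, length_edges]
  · have ht : (p.transfer _ hmem).IsTrail := by
      rw [isTrail_def, edges_transfer]
      exact hp.edges_nodup
    refine ht.isEulerian_of_forall_mem fun e he => ?_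
    rw [edges_transfer]
    rwa [hS] at he

/-- A trail in the complement of the standard cycle on `ZMod n` that starts at `0` can be
transported along a Hamiltonian cycle, and then appended to it. -/
theorem IsHamiltonianCycle.exists_eulerian_of_zmod_trail {n : ℕ} [NeZero n] {a : Fin n}
    {C : (⊤ : SimpleGraph (Fin n)).Walk a a} (hC : C.IsHamiltonianCycle)
    (w : ℕ → ZMod n) (m : ℕ) (h0 : w 0 = 0) (hne : ∀ i < m, w i ≠ w (i + 1))
    (hcyc : ∀ i < m, ∀ z, s(w i, w (i + 1)) ≠ s(z, z + 1))
    (hinj : ∀ i < m, ∀ j < m, s(w i, w (i + 1)) = s(w j, w (j + 1)) → i = j) :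
    ∃ S : SimpleGraph (Fin n), S.edgeSet.ncard = n + m ∧ (∀ e ∈ C.edges, e ∈ S.edgeSet) ∧
      ∃ (u v : Fin n) (p : S.Walk u v), p.IsEulerian := by
  have hlen : C.length = n := by simpa using hC.length_eq
  let c : ZMod n → Fin n := fun z => C.getVert z.val
  have hc : Function.Injective c := by
    intro x y hxy
    have hx := ZMod.val_lt x
    have hy := ZMod.val_lt y
    exact ZMod.val_injective n <|
      hC.isCycle.getVert_injOn' (by simp; lia) (by simp; lia) hxy
  have hc_cast : ∀ i ≤ n, c (i : ZMod n) = C.getVert i := by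
    intro i hi
    obtain h | hi := hi.eq_or_lt
    · simp [c, h, getVert_of_length_le C hlen.le]
    · simp only [c, ZMod.val_cast_of_lt hi]
  have hc0 : c (w 0) = a := by simp [c, h0]
  obtain ⟨q, hq⟩ := exists_edges_eq_map_range (G := ⊤) (fun i => c (w i)) m
    fun i hi => by simpa using hc.ne (hne i hi)
  have hcinj := Sym2.map.injective hc
  have hqt : q.IsTrail := by
    rw [isTrail_def, hq]
    refine List.Nodup.map_on (fun i hi j hj hij => ?_) List.nodup_range
    rw [List.mem_range] at hi hj
    exact hinj i hi j hj (hcinj (by simpa using hij))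
  have hdisj : C.edges.Disjoint q.edges := by
    intro e heC heq
    rw [hq, List.mem_map] at heq
    obtain ⟨i, hi, rfl⟩ := heq
    obtain ⟨j, hj, hij⟩ := (mk_mem_edges_iff_exists C).1 heC
    rw [hlen] at hj
    rw [← hc_cast j hj.le, ← hc_cast (j + 1) hj] at hij
    refine hcyc i (List.mem_range.1 hi) j (hcinj ?_)
    simpa using hij.symm
  have ht : (C.append (q.copy hc0 rfl)).IsTrail := by
    simpa [hC.isCycle.isTrail, hqt] using hdisj
  have hql : q.length = m := by rw [← length_edges, hq]; simp
  obtain ⟨S, hcard, hmem, p, hp⟩ := ht.exists_isEulerian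
  refine ⟨S, by simpa [hlen, hql] using hcard, fun e he => hmem e ?_, _, _, p, hp⟩
  simp [he]

end SimpleGraph.Walk

namespace ZMod

/-- A chord of the regular `n`-gon that is not a diameter determines its length and its
initial vertex. -/
theorem eq_and_eq_of_mk_add_eq {n : ℕ} {x y : ZMod n} {d e : ℕ} (hd : 0 < d) (hdn : 2 * d < n)
    (hen : 2 * e < n) (h : s(x, x + d) = s(y, y + e)) : x = y ∧ d = e := by
  rcases Sym2.eq_iff.1 h with ⟨rfl, h⟩ | ⟨h₁, h₂⟩
  · refine ⟨rfl, ?_⟩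
    have h := (ZMod.natCast_eq_natCast_iff' _ _ _).1 (add_left_cancel h)
    rwa [Nat.mod_eq_of_lt (by lia), Nat.mod_eq_of_lt (by lia)] at h
  · have h : ((d + e : ℕ) : ZMod n) = 0 := by
      push_cast
      linear_combination h₂ - h₁
    have := Nat.le_of_dvd (by lia) ((ZMod.natCast_eq_zero_iff _ _).1 h)
    lia

/-- The zigzag sequence in `ZMod n` with steps `2, -3, 2, -3, …` for the first `2 * n` steps,
then `4, -5, 4, -5, …` for the next `2 * n` steps, and so on. -/
def zigzag (n j : ℕ) : ZMod n :=
  -((j / 2 : ℕ) : ZMod n) + ((j % 2 * (2 * (j / (2 * n)) + 2) : ℕ) : ZMod n)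

theorem mk_zigzag_succ (n j : ℕ) :
    s(zigzag n j, zigzag n (j + 1)) =
      s(-(((j + 1) / 2 : ℕ) : ZMod n),
        -(((j + 1) / 2 : ℕ) : ZMod n) + ((2 * (j / (2 * n)) + 2 + j % 2 : ℕ) : ZMod n)) := by
  obtain ⟨h, rfl | rfl⟩ := j.even_or_odd'
  · have h₁ : (2 * h + 1) / 2 = h := by lia
    have h₂ : (2 * h + 1) / (2 * n) = h / n := by rw [← Nat.div_div_eq_div_mul, h₁]
    have h₃ : 2 * h / 2 = h := by lia
    have h₄ : 2 * h / (2 * n) = h / n := by rw [← Nat.div_div_eq_div_mul, h₃]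
    simp [zigzag, h₁, h₂, h₄, Nat.add_mod]
  · have h₁ : (2 * h + 1) / 2 = h := by lia
    have h₂ : (2 * h + 1) / (2 * n) = h / n := by rw [← Nat.div_div_eq_div_mul, h₁]
    have h₃ : (2 * h + 1 + 1) / 2 = h + 1 := by lia
    have h₄ : (2 * h + 1) % 2 = 1 := by lia
    have h₅ : (2 * h + 1 + 1) % 2 = 0 := by lia
    rw [Sym2.eq_swap]
    simp only [zigzag, h₁, h₂, h₃, h₄, h₅]
    push_cast
    exact congrArg₂ (fun x y => s(x, y)) (by ring) (by ring)

theorem zigzag_step_lt {n t j : ℕ} (ht : 4 * t + 2 < n) (hj : j < 2 * n * t) :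
    2 * (2 * (j / (2 * n)) + 2 + j % 2) < n := by
  have := Nat.div_lt_of_lt_mul hj
  lia

theorem eq_of_mk_zigzag_eq {n t i j : ℕ} (ht : 4 * t + 2 < n) (hi : i < 2 * n * t)
    (hj : j < 2 * n * t)
    (h : s(zigzag n i, zigzag n (i + 1)) = s(zigzag n j, zigzag n (j + 1))) : i = j := by
  rw [mk_zigzag_succ, mk_zigzag_succ] at h
  obtain ⟨hx, hd⟩ := eq_and_eq_of_mk_add_eq (by lia) (zigzag_step_lt ht hi)
    (zigzag_step_lt ht hj) h
  have hpar : i % 2 = j % 2 := by lia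
  have hquot : i / 2 / n = j / 2 / n := by
    rw [Nat.div_div_eq_div_mul, Nat.div_div_eq_div_mul]
    lia
  have hmod : i / 2 % n = j / 2 % n := by
    rw [neg_inj, show (i + 1) / 2 = i / 2 + i % 2 by lia,
      show (j + 1) / 2 = j / 2 + i % 2 by lia] at hx
    push_cast at hx
    exact (ZMod.natCast_eq_natCast_iff' _ _ _).1 (add_right_cancel hx)
  have : i / 2 = j / 2 := by rw [← Nat.div_add_mod (i / 2) n, ← Nat.div_add_mod (j / 2) n,
    hquot, hmod]
  lia

end ZMod

/-- Let `k ≥ 7` and let `n` satisfy `n(n−1)/2 ∈ {2k − 3, 2k − 2}`. Let `C` be a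
Hamiltonian cycle of the complete graph `K_n`. Then `K_n` contains a subgraph `S` with
exactly `k + 1` edges containing all edges of `C` that admits a trail using every edge
of `S` exactly once (an Eulerian trail or circuit of `S`). -/
theorem exists_eulerian_subgraph_containing_hamiltonian_cycle
    (k n : ℕ) (hk : 7 ≤ k)
    (hn : n * (n - 1) / 2 = 2 * k - 3 ∨ n * (n - 1) / 2 = 2 * k - 2)
    (a : Fin n) (C : (⊤ : SimpleGraph (Fin n)).Walk a a)
    (hC : C.IsHamiltonianCycle) :
    ∃ S : SimpleGraph (Fin n),
      S.edgeSet.ncard = k + 1 ∧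
      (∀ e ∈ C.edges, e ∈ S.edgeSet) ∧
      ∃ (u v : Fin n) (p : S.Walk u v), p.IsEulerian := by
  have h₂ : 2 ∣ n * (n - 1) := (Nat.even_mul_pred_self n).two_dvd
  have hn6 : 6 ≤ n := by
    by_contra! h
    interval_cases n <;> lia
  have : NeZero n := ⟨by lia⟩
  obtain ⟨l, rfl⟩ : ∃ l, n = l + 1 := ⟨n - 1, by lia⟩
  rw [Nat.add_sub_cancel] at hn h₂
  have hk_eq : 4 * k = (l + 1) * l + 6 ∨ 4 * k = (l + 1) * l + 4 := by lia
  obtain ⟨m, hm⟩ : ∃ m, k + 1 = l + 1 + m := by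
    have : l ≤ k := by rcases hk_eq with h | h <;> nlinarith
    exact ⟨k - l, by lia⟩
  rw [hm]
  obtain h | hl := (show l = 5 ∨ 6 ≤ l by lia)
  · subst h
    obtain rfl : m = 4 := by lia
    refine hC.exists_eulerian_of_zmod_trail
      (fun i => ([0, 2, 5, 3, 0] : List (ZMod 6)).getD i 0) 4 rfl ?_ ?_ ?_ <;> decide
  · have ht : 4 * ((l - 2) / 4) + 2 < l + 1 := by lia
    have hmt : m ≤ 2 * (l + 1) * ((l - 2) / 4) := by
      obtain h | h | hl := (show l = 6 ∨ l = 7 ∨ 8 ≤ l by lia)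
      · subst h
        lia
      · subst h
        lia
      · have : l ≤ 4 * ((l - 2) / 4) + 5 := by lia
        generalize (l - 2) / 4 = t at this
        have h := Nat.mul_le_mul_left (l + 1) this
        have h' := Nat.mul_le_mul_right l hl
        have h_upper : 4 * k ≤ (l + 1) * l + 6 := by lia
        nlinarith
    refine hC.exists_eulerian_of_zmod_trail (ZMod.zigzag (l + 1)) m (by simp [ZMod.zigzag])
      (fun i hi heq => ?_) (fun i hi z h => ?_)
      fun i hi j hj => ZMod.eq_of_mk_zigzag_eq ht (hi.trans_le hmt) (hj.trans_le hmt)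
    · have h := ZMod.mk_zigzag_succ (l + 1) i
      rw [← heq] at h
      have := (ZMod.eq_and_eq_of_mk_add_eq (e := 0) (by lia)
        (ZMod.zigzag_step_lt ht (hi.trans_le hmt)) (by lia) (by simpa using h.symm)).2
      lia
    · rw [ZMod.mk_zigzag_succ] at h
      have := (ZMod.eq_and_eq_of_mk_add_eq (e := 1) (by lia)
        (ZMod.zigzag_step_lt ht (hi.trans_le hmt)) (by lia) (by simpa using h)).2
      lia
end
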